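/- Let k ∈ ℕ, n : Fin k → ℕ, and ι = Σ i : Fin k, Fin (n i). For any block off-diagonal matrix B : Matrix ι ι ℂ: (1) ǰ(ǰB) = −B; and (2) if B is Hermitian then ǰB is Hermitian. In particular the map B ↦ ǰB is an automorphism of the space of block off-diagonal Hermitian matrices squaring to minus the identity. -/

import Mathlib

open Matrix Finset

/-- The map `M ↦ ǰM` on block off-diagonal matrices: multiply the block above the
diagonal by `I` and the block below the diagonal by `−I`. -/
noncomputable def jmap {k : ℕ} {n : Fin k → ℕ}
    (M : Matrix (Σ i : Fin k, Fin (n i)) (Σ i : Fin k, Fin (n i)) ℂ) :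
    Matrix (Σ i : Fin k, Fin (n i)) (Σ i : Fin k, Fin (n i)) ℂ :=
  Matrix.of fun x y =>
    if x.1 < y.1 then Complex.I * M x y
    else if y.1 < x.1 then -(Complex.I * M x y)
    else 0

/-- `ǰ` is an almost complex structure on block off-diagonal Hermitian matrices:
`ǰ(ǰB) = −B`, and `ǰB` is Hermitian whenever `B` is. -/
theorem jmap_almost_complex_structure
    (k : ℕ) (n : Fin k → ℕ)
    (B : Matrix (Σ i : Fin k, Fin (n i)) (Σ i : Fin k, Fin (n i)) ℂ)
    (hBoff : ∀ x y : (Σ i : Fin k, Fin (n i)), x.1 = y.1 → B x y = 0) :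
    jmap (jmap B) = -B ∧ (B.IsHermitian → (jmap B).IsHermitian) := by
  refine ⟨?_, fun hB => ?_⟩
  · ext x y
    rcases lt_trichotomy x.1 y.1 with h | h | h
    · simp [jmap, h, ← mul_assoc]
    · simp [jmap, h, hBoff x y h]
    · simp [jmap, h, h.not_gt, ← mul_assoc]
  · ext x y
    have hxy : (starRingEnd ℂ) (B y x) = B x y := hB.apply x y
    rcases lt_trichotomy x.1 y.1 with h | h | h
    · simp [jmap, h, h.not_gt, hxy]
    · simp [jmap, h]
    · simp [jmap, h, h.not_gt, hxy]
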